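/- The linear span M = span_ℂ{ e^μ − ε(w)·e^{wμ} : μ ∈ Λ, w ∈ W } is a ℂ[Λ]^W-submodule of ℂ[Λ], and the alternating map alt induces an isomorphism of ℂ[Λ]^W-modules from the quotient ℂ[Λ]/M onto the space ℂ[Λ]^{W,−} of skew-invariant elements. -/

import Mathlib

noncomputable section

namespace CS

open scoped RealInnerProductSpace
open Finsupp

variable {V : Type} [NormedAddCommGroup V] [InnerProductSpace ℝ V] [FiniteDimensional ℝ V]

/-- The coroot pairing `⟨v, α^∨⟩ = 2⟪v,α⟫/⟪α,α⟫`. -/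
def pair (v α : V) : ℝ := 2 * ⟪v, α⟫ / ⟪α, α⟫

/-- A reduced crystallographic root system spanning `V`. -/
structure IsRootSystem (Φ : Set V) : Prop where
  finite : Φ.Finite
  ne_zero : (0 : V) ∉ Φ
  span_top : Submodule.span ℝ Φ = ⊤
  reflect_mem : ∀ α ∈ Φ, ∀ β ∈ Φ, β - pair β α • α ∈ Φ
  crystallographic : ∀ α ∈ Φ, ∀ β ∈ Φ, ∃ k : ℤ, pair β α = k
  reduced : ∀ α ∈ Φ, ∀ c : ℝ, c • α ∈ Φ → c = 1 ∨ c = -1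

/-- `P` is a system of positive roots for `Φ`. -/
def IsPositiveSystem (Φ P : Set V) : Prop :=
  P ⊆ Φ ∧ (∀ α ∈ Φ, (α ∈ P ∨ -α ∈ P) ∧ ¬(α ∈ P ∧ -α ∈ P)) ∧
    (∀ α ∈ P, ∀ β ∈ P, α + β ∈ Φ → α + β ∈ P)

/-- The simple roots: indecomposable positive roots. -/
def simpleRoots (P : Set V) : Set V := {α ∈ P | ¬∃ β ∈ P, ∃ γ ∈ P, α = β + γ}

/-- Half the sum of the positive roots. -/
def rho (P : Set V) : V := (2 : ℝ)⁻¹ • ∑ᶠ α ∈ P, α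

/-- The weight lattice `Λ`. -/
def weightLattice (Φ : Set V) : AddSubgroup V where
  carrier := {v | ∀ α ∈ Φ, ∃ k : ℤ, pair v α = k}
  zero_mem' := fun α _ => ⟨0, by simp [pair]⟩
  add_mem' := by
    rintro a b ha hb α hα
    obtain ⟨k, hk⟩ := ha α hα
    obtain ⟨l, hl⟩ := hb α hα
    refine ⟨k + l, ?_⟩
    push_cast
    rw [← hk, ← hl]
    simp only [pair, inner_add_left]
    ring
  neg_mem' := by
    rintro a ha α hα
    obtain ⟨k, hk⟩ := ha α hα
    refine ⟨-k, ?_⟩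
    push_cast
    rw [← hk]
    simp only [pair, inner_neg_left]
    ring

/-- The Weyl group: the subgroup generated by the reflections in the roots. -/
def weylGroup (Φ : Set V) : Subgroup (V ≃ₗ[ℝ] V) :=
  Subgroup.closure {s | ∃ α ∈ Φ, ∀ v, s v = v - pair v α • α}

/-- The sign character `ε(w) = det w`, as a complex number. -/
def sgn (w : V ≃ₗ[ℝ] V) : ℂ := ((LinearMap.det (w : V →ₗ[ℝ] V) : ℝ) : ℂ)

section stability

variable {Φ : Set V}

lemma sα_inner (hΦ : IsRootSystem Φ) {α : V} (hα : α ∈ Φ) (v β : V) :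
    ⟪v - pair v α • α, β⟫ = ⟪v, β - pair β α • α⟫ := by
  simp only [pair, inner_sub_left, inner_sub_right, real_inner_smul_left,
    real_inner_smul_right]
  rw [real_inner_comm α β]
  ring

lemma sα_norm (hΦ : IsRootSystem Φ) {α : V} (hα : α ∈ Φ) (β : V) :
    ⟪β - pair β α • α, β - pair β α • α⟫ = ⟪β, β⟫ := by
  have hα0 : α ≠ 0 := fun h => hΦ.ne_zero (h ▸ hα)
  have hne : ⟪α, α⟫ ≠ 0 := (inner_self_ne_zero (𝕜 := ℝ)).mpr hα0
  simp only [pair, inner_sub_left, inner_sub_right, real_inner_smul_left,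
    real_inner_smul_right]
  rw [real_inner_comm α β]
  field_simp
  ring

lemma sα_mem_lattice (hΦ : IsRootSystem Φ) {α : V} (hα : α ∈ Φ)
    {v : V} (hv : v ∈ weightLattice Φ) : v - pair v α • α ∈ weightLattice Φ := by
  intro β hβ
  obtain ⟨k, hk⟩ := hv _ (hΦ.reflect_mem α hα β hβ)
  refine ⟨k, ?_⟩
  rw [← hk]
  have h1 := sα_inner hΦ hα v β
  have h2 := sα_norm hΦ hα β
  simp only [pair] at h1 h2 ⊢
  rw [h1, h2]

end stability

end CS

namespace CS

open scoped RealInnerProductSpace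

variable {V : Type} [NormedAddCommGroup V] [InnerProductSpace ℝ V] [FiniteDimensional ℝ V]
variable {Φ : Set V}

lemma sα_invol (hΦ : IsRootSystem Φ) {α : V} (hα : α ∈ Φ) {s : V ≃ₗ[ℝ] V}
    (hs : ∀ v, s v = v - pair v α • α) (v : V) : s (s v) = v := by
  have hα0 : α ≠ 0 := fun h => hΦ.ne_zero (h ▸ hα)
  have hne : ⟪α, α⟫ ≠ 0 := (inner_self_ne_zero (𝕜 := ℝ)).mpr hα0
  have hpair : pair (v - pair v α • α) α = -pair v α := by
    simp only [pair, inner_sub_left, real_inner_smul_left]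
    field_simp
    ring
  rw [hs, hs, hpair]
  module

lemma weyl_stable (hΦ : IsRootSystem Φ) {w : V ≃ₗ[ℝ] V} (hw : w ∈ weylGroup Φ)
    {v : V} (hv : v ∈ weightLattice Φ) : w v ∈ weightLattice Φ := by
  revert v
  suffices h : (∀ v ∈ weightLattice Φ, w v ∈ weightLattice Φ) ∧
      (∀ v ∈ weightLattice Φ, w⁻¹ v ∈ weightLattice Φ) from fun v hv => h.1 v hv
  induction hw using Subgroup.closure_induction with
  | mem s hs =>
    obtain ⟨α, hα, hsα⟩ := hs
    have h1 : ∀ v ∈ weightLattice Φ, s v ∈ weightLattice Φ := by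
      intro v hv
      rw [hsα]
      exact sα_mem_lattice hΦ hα hv
    refine ⟨h1, ?_⟩
    have hss : s * s = 1 := by
      apply LinearEquiv.toLinearMap_injective
      apply LinearMap.ext
      intro v
      simpa using sα_invol hΦ hα hsα v
    have hinv : s⁻¹ = s := inv_eq_of_mul_eq_one_right hss
    rw [hinv]
    exact h1
  | one =>
    constructor <;> (intro v hv; simpa using hv)
  | mul a b _ _ pa pb =>
    constructor
    · intro v hv
      have : (a * b) v = a (b v) := rfl
      rw [this]
      exact pa.1 _ (pb.1 v hv)
    · intro v hv
      have : (a * b)⁻¹ v = b⁻¹ (a⁻¹ v) := by rw [mul_inv_rev]; rfl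
      rw [this]
      exact pb.2 _ (pa.2 v hv)
  | inv a _ pa =>
    refine ⟨pa.2, ?_⟩
    intro v hv
    rw [inv_inv]
    exact pa.1 v hv

/-- The group algebra `ℂ[Λ]`. -/
abbrev GA (Φ : Set V) := AddMonoidAlgebra ℂ ↥(weightLattice Φ)

/-- `e^μ`, the basis element of `ℂ[Λ]` attached to `μ ∈ Λ`. -/
def e (μ : ↥(weightLattice Φ)) : GA Φ := AddMonoidAlgebra.single μ 1

/-- The action of `w ∈ W` on the lattice `Λ`. -/
def latHom (hΦ : IsRootSystem Φ) {w : V ≃ₗ[ℝ] V} (hw : w ∈ weylGroup Φ) :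
    weightLattice Φ →+ weightLattice Φ where
  toFun x := ⟨w x, weyl_stable hΦ hw x.2⟩
  map_zero' := by ext; simp
  map_add' x y := by ext; simp

/-- The action of `w ∈ W` on the group algebra `ℂ[Λ]`. -/
def act (hΦ : IsRootSystem Φ) {w : V ≃ₗ[ℝ] V} (hw : w ∈ weylGroup Φ) :
    GA Φ →ₐ[ℂ] GA Φ :=
  AddMonoidAlgebra.mapDomainAlgHom ℂ ℂ (latHom hΦ hw)

/-- The alternation map `alt f = ∑_{w ∈ W} ε(w) • (w · f)`. -/
def alt (hΦ : IsRootSystem Φ) (f : GA Φ) : GA Φ :=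
  ∑ᶠ w : ↥(weylGroup Φ), sgn (w : V ≃ₗ[ℝ] V) • act hΦ w.2 f

/-- `W`-invariant elements of `ℂ[Λ]`, i.e. members of `ℂ[Λ]^W`. -/
def IsInvariant (hΦ : IsRootSystem Φ) (a : GA Φ) : Prop :=
  ∀ (w : V ≃ₗ[ℝ] V) (hw : w ∈ weylGroup Φ), act hΦ hw a = a

/-- `W`-skew-invariant elements of `ℂ[Λ]`, i.e. members of `ℂ[Λ]^{W,-}`. -/
def IsSkewInvariant (hΦ : IsRootSystem Φ) (f : GA Φ) : Prop :=
  ∀ (w : V ≃ₗ[ℝ] V) (hw : w ∈ weylGroup Φ), act hΦ hw f = sgn w • f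

/-- `ℂ[Λ]^{W,-}` as a complex subspace of `ℂ[Λ]`. -/
def skewSubmodule (hΦ : IsRootSystem Φ) : Submodule ℂ (GA Φ) where
  carrier := {f | IsSkewInvariant hΦ f}
  add_mem' := by
    intro a b ha hb w hw
    rw [map_add, ha w hw, hb w hw, smul_add]
  zero_mem' := by
    intro w hw
    rw [map_zero, smul_zero]
  smul_mem' := by
    intro c f hf w hw
    rw [map_smul, hf w hw, smul_comm]

/-- `ℂ[Λ]^W` as a subalgebra of `ℂ[Λ]`. -/
def invSubalgebra (hΦ : IsRootSystem Φ) : Subalgebra ℂ (GA Φ) where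
  carrier := {a | IsInvariant hΦ a}
  mul_mem' := by
    intro a b ha hb w hw
    rw [map_mul, ha w hw, hb w hw]
  one_mem' := by
    intro w hw
    rw [map_one]
  add_mem' := by
    intro a b ha hb w hw
    rw [map_add, ha w hw, hb w hw]
  zero_mem' := by
    intro w hw
    rw [map_zero]
  algebraMap_mem' := by
    intro c w hw
    exact (act hΦ hw).commutes c

/-- `ℂ[Λ]^{W,-}` as a module over `ℂ[Λ]^W`. -/
def skewSubmoduleW (hΦ : IsRootSystem Φ) : Submodule ↥(invSubalgebra hΦ) (GA Φ) where
  carrier := {f | IsSkewInvariant hΦ f}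
  add_mem' := by
    intro a b ha hb w hw
    rw [map_add, ha w hw, hb w hw, smul_add]
  zero_mem' := by
    intro w hw
    rw [map_zero, smul_zero]
  smul_mem' := by
    intro c f hf w hw
    rw [Subalgebra.smul_def, smul_eq_mul, map_mul, c.2 w hw, hf w hw, mul_smul_comm]

/-- The generators `e^μ - ε(w)·e^{wμ}` of the kernel of `alt`. -/
def kerGens (hΦ : IsRootSystem Φ) : Set (GA Φ) :=
  {x | ∃ (μ : ↥(weightLattice Φ)) (w : V ≃ₗ[ℝ] V) (hw : w ∈ weylGroup Φ),
    x = e μ - sgn w • e (latHom hΦ hw μ)}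

end CS

namespace CS

variable {V : Type} [NormedAddCommGroup V] [InnerProductSpace ℝ V] [FiniteDimensional ℝ V]
variable {Φ : Set V}

lemma sgn_mul (a b : V ≃ₗ[ℝ] V) : sgn (a * b) = sgn a * sgn b := by
  have h : ((a * b : V ≃ₗ[ℝ] V) : V →ₗ[ℝ] V) = (a : V →ₗ[ℝ] V) ∘ₗ (b : V →ₗ[ℝ] V) := rfl
  rw [sgn, h, LinearMap.det_comp, Complex.ofReal_mul, sgn, sgn]

lemma sgn_one : sgn (1 : V ≃ₗ[ℝ] V) = 1 := by
  simp [sgn]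

lemma sgn_mul_self (hΦ : IsRootSystem Φ) {w : V ≃ₗ[ℝ] V} (hw : w ∈ weylGroup Φ) :
    sgn w * sgn w = 1 := by
  induction hw using Subgroup.closure_induction with
  | mem s hs =>
    obtain ⟨α, hα, hsα⟩ := hs
    have hss : s * s = 1 := LinearEquiv.ext fun v => sα_invol hΦ hα hsα v
    rw [← sgn_mul, hss, sgn_one]
  | one => simp [sgn_one]
  | mul a b _ _ ha hb =>
    rw [sgn_mul, mul_mul_mul_comm, ha, hb, one_mul]
  | inv a _ ha =>
    have h : sgn a * sgn a⁻¹ = 1 := by rw [← sgn_mul, mul_inv_cancel, sgn_one]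
    calc sgn a⁻¹ * sgn a⁻¹ = (sgn a * sgn a) * (sgn a⁻¹ * sgn a⁻¹) := by rw [ha, one_mul]
      _ = 1 := by rw [mul_mul_mul_comm, h, one_mul]

lemma weyl_mapsTo_roots (hΦ : IsRootSystem Φ) {w : V ≃ₗ[ℝ] V} (hw : w ∈ weylGroup Φ) :
    Set.MapsTo w Φ Φ := by
  suffices h : Set.MapsTo w Φ Φ ∧ Set.MapsTo (w⁻¹ : V ≃ₗ[ℝ] V) Φ Φ from h.1
  induction hw using Subgroup.closure_induction with
  | mem s hs =>
    obtain ⟨α, hα, hsα⟩ := hs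
    have hss : s * s = 1 := LinearEquiv.ext fun v => sα_invol hΦ hα hsα v
    have h : Set.MapsTo s Φ Φ := fun β hβ => by
      rw [hsα]
      exact hΦ.reflect_mem α hα β hβ
    rw [inv_eq_of_mul_eq_one_right hss]
    exact ⟨h, h⟩
  | one => exact ⟨fun _ h => h, fun _ h => by simpa using h⟩
  | mul a b _ _ ha hb =>
    refine ⟨ha.1.comp hb.1, ?_⟩
    rw [mul_inv_rev]
    exact hb.2.comp ha.2
  | inv a _ ha => exact ⟨ha.2, by simpa only [inv_inv] using ha.1⟩

lemma weylGroup_finite (hΦ : IsRootSystem Φ) : Finite (weylGroup Φ) := by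
  have : Finite Φ := hΦ.finite
  refine Finite.of_injective
    (fun w : weylGroup Φ => (weyl_mapsTo_roots hΦ w.2).restrict) fun a b hab => ?_
  apply Subtype.ext
  apply LinearEquiv.toLinearMap_injective
  refine LinearMap.ext_on hΦ.span_top fun α hα => ?_
  exact congrArg Subtype.val (congrFun hab ⟨α, hα⟩)

lemma act_e (hΦ : IsRootSystem Φ) {w : V ≃ₗ[ℝ] V} (hw : w ∈ weylGroup Φ)
    (μ : weightLattice Φ) : act hΦ hw (e μ) = e (latHom hΦ hw μ) := by
  simp [act, e]

/-- Two linear maps on `ℂ[Λ]` agreeing on the basis `e^μ` are equal. -/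
lemma linearMap_ext_e {N : Type*} [AddCommMonoid N] [Module ℂ N] {f g : GA Φ →ₗ[ℂ] N}
    (h : ∀ μ, f (e μ) = g (e μ)) : f = g := by
  refine AddMonoidAlgebra.lhom_ext' fun μ => LinearMap.ext_ring ?_
  exact h μ

lemma span_range_e : Submodule.span ℂ (Set.range (e : weightLattice Φ → GA Φ)) = ⊤ := by
  rw [← Submodule.ker_mkQ (Submodule.span ℂ (Set.range (e : weightLattice Φ → GA Φ))),
    LinearMap.ker_eq_top]
  refine linearMap_ext_e fun μ => ?_
  simpa using Submodule.subset_span (Set.mem_range_self μ)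

lemma act_mul (hΦ : IsRootSystem Φ) (a b : weylGroup Φ) (f : GA Φ) :
    act hΦ (a * b).2 f = act hΦ a.2 (act hΦ b.2 f) := by
  have h : (act hΦ (a * b).2).toLinearMap =
      (act hΦ a.2).toLinearMap ∘ₗ (act hΦ b.2).toLinearMap := by
    refine linearMap_ext_e fun μ => ?_
    simp only [AlgHom.toLinearMap_apply, LinearMap.comp_apply, act_e]
    rfl
  exact LinearMap.congr_fun h f

lemma alt_eq_sum (hΦ : IsRootSystem Φ) [Fintype (weylGroup Φ)] (f : GA Φ) :
    alt hΦ f = ∑ w : weylGroup Φ, sgn (w : V ≃ₗ[ℝ] V) • act hΦ w.2 f :=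
  finsum_eq_sum_of_fintype _

lemma alt_isSkewInvariant (hΦ : IsRootSystem Φ) (f : GA Φ) : IsSkewInvariant hΦ (alt hΦ f) := by
  intro w hw
  have := weylGroup_finite hΦ
  have := Fintype.ofFinite (weylGroup Φ)
  rw [alt_eq_sum, map_sum, Finset.smul_sum]
  refine Fintype.sum_equiv (Equiv.mulLeft (⟨w, hw⟩ : weylGroup Φ)) _ _ fun u => ?_
  rw [Equiv.coe_mulLeft, act_mul, map_smul, Subgroup.coe_mul, sgn_mul, smul_smul, ← mul_assoc,
    sgn_mul_self hΦ hw, one_mul]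

lemma alt_act (hΦ : IsRootSystem Φ) {w : V ≃ₗ[ℝ] V} (hw : w ∈ weylGroup Φ) (f : GA Φ) :
    alt hΦ (act hΦ hw f) = sgn w • alt hΦ f := by
  have := weylGroup_finite hΦ
  have := Fintype.ofFinite (weylGroup Φ)
  rw [alt_eq_sum, alt_eq_sum, Finset.smul_sum]
  refine Fintype.sum_equiv (Equiv.mulRight (⟨w, hw⟩ : weylGroup Φ)) _ _ fun u => ?_
  rw [Equiv.coe_mulRight, act_mul, Subgroup.coe_mul, sgn_mul, smul_smul,
    mul_left_comm, sgn_mul_self hΦ hw, mul_one]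

lemma alt_of_isSkewInvariant (hΦ : IsRootSystem Φ) {f : GA Φ} (hf : IsSkewInvariant hΦ f) :
    alt hΦ f = (Nat.card (weylGroup Φ) : ℂ) • f := by
  have := weylGroup_finite hΦ
  have := Fintype.ofFinite (weylGroup Φ)
  have h (w : weylGroup Φ) : sgn (w : V ≃ₗ[ℝ] V) • act hΦ w.2 f = f := by
    rw [hf w w.2, smul_smul, sgn_mul_self hΦ w.2, one_smul]
  simp only [alt_eq_sum, h, Finset.sum_const, Finset.card_univ, Nat.card_eq_fintype_card,
    Nat.cast_smul_eq_nsmul]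

lemma card_weylGroup_ne_zero (hΦ : IsRootSystem Φ) : (Nat.card (weylGroup Φ) : ℂ) ≠ 0 := by
  have := weylGroup_finite hΦ
  exact Nat.cast_ne_zero.mpr Nat.card_pos.ne'

/-- The alternation map as a homomorphism of `ℂ[Λ]^W`-modules onto the skew-invariants. -/
def altHom (hΦ : IsRootSystem Φ) : GA Φ →ₗ[invSubalgebra hΦ] skewSubmoduleW hΦ where
  toFun f := ⟨alt hΦ f, alt_isSkewInvariant hΦ f⟩
  map_add' f g := by
    have := weylGroup_finite hΦ
    have := Fintype.ofFinite (weylGroup Φ)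
    apply Subtype.ext
    simp only [alt_eq_sum, map_add, smul_add, Finset.sum_add_distrib, Submodule.coe_add]
  map_smul' a f := by
    have := weylGroup_finite hΦ
    have := Fintype.ofFinite (weylGroup Φ)
    apply Subtype.ext
    change alt hΦ ((a : GA Φ) * f) = (a : GA Φ) * alt hΦ f
    simp only [alt_eq_sum, Finset.mul_sum, map_mul, a.2 _ (Subtype.property _), mul_smul_comm]

lemma coe_altHom (hΦ : IsRootSystem Φ) (f : GA Φ) : (altHom hΦ f : GA Φ) = alt hΦ f := rfl

lemma alt_smul (hΦ : IsRootSystem Φ) (c : ℂ) (f : GA Φ) : alt hΦ (c • f) = c • alt hΦ f := by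
  have := weylGroup_finite hΦ
  have := Fintype.ofFinite (weylGroup Φ)
  simp only [alt_eq_sum, map_smul, Finset.smul_sum, smul_comm c]

lemma altHom_surjective (hΦ : IsRootSystem Φ) : Function.Surjective (altHom hΦ) := by
  rintro ⟨g, hg⟩
  refine ⟨(Nat.card (weylGroup Φ) : ℂ)⁻¹ • g, Subtype.ext ?_⟩
  rw [coe_altHom, alt_smul, alt_of_isSkewInvariant hΦ hg,
    inv_smul_smul₀ (card_weylGroup_ne_zero hΦ)]

lemma sub_smul_act_mem (hΦ : IsRootSystem Φ) {w : V ≃ₗ[ℝ] V} (hw : w ∈ weylGroup Φ)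
    (f : GA Φ) : f - sgn w • act hΦ hw f ∈ Submodule.span ℂ (kerGens hΦ) := by
  have hf : f ∈ Submodule.span ℂ (Set.range (e : weightLattice Φ → GA Φ)) := by
    rw [span_range_e]
    exact Submodule.mem_top
  induction hf using Submodule.span_induction with
  | mem x hx =>
    obtain ⟨μ, rfl⟩ := hx
    rw [act_e]
    exact Submodule.subset_span ⟨μ, w, hw, rfl⟩
  | zero => simp
  | add x y _ _ hx hy =>
    rw [map_add, smul_add, add_sub_add_comm]
    exact add_mem hx hy
  | smul c x _ hx =>
    rw [map_smul, smul_comm, ← smul_sub]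
    exact Submodule.smul_mem _ c hx

lemma alt_eq_zero_iff (hΦ : IsRootSystem Φ) (f : GA Φ) :
    alt hΦ f = 0 ↔ f ∈ Submodule.span ℂ (kerGens hΦ) := by
  have := weylGroup_finite hΦ
  have := Fintype.ofFinite (weylGroup Φ)
  constructor
  · intro hf
    have h : ∑ w : weylGroup Φ, (f - sgn (w : V ≃ₗ[ℝ] V) • act hΦ w.2 f) ∈
        Submodule.span ℂ (kerGens hΦ) := sum_mem fun w _ => sub_smul_act_mem hΦ w.2 f
    rw [Finset.sum_sub_distrib, ← alt_eq_sum, hf, sub_zero, Finset.sum_const, Finset.card_univ,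
      ← Nat.card_eq_fintype_card, ← Nat.cast_smul_eq_nsmul ℂ] at h
    exact (Submodule.smul_mem_iff _ (card_weylGroup_ne_zero hΦ)).mp h
  · intro hf
    induction hf using Submodule.span_induction with
    | mem x hx =>
      obtain ⟨μ, w, hw, rfl⟩ := hx
      rw [← act_e, ← coe_altHom, map_sub, Submodule.coe_sub, coe_altHom, coe_altHom, alt_smul,
        alt_act, smul_smul, sgn_mul_self hΦ hw, one_smul, sub_self]
    | zero => rw [← coe_altHom, map_zero, Submodule.coe_zero]
    | add x y _ _ hx hy =>
      rw [← coe_altHom] at hx hy ⊢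
      rw [map_add, Submodule.coe_add, hx, hy, add_zero]
    | smul c x _ hx => rw [alt_smul, hx, smul_zero]

/-- The first isomorphism theorem, with only an additive monoid structure on the codomain. -/
lemma exists_quotKerEquiv {R M N : Type*} [Ring R] [AddCommGroup M] [Module R M]
    [AddCommMonoid N] [Module R N] (f : M →ₗ[R] N) (hf : Function.Surjective f) :
    ∃ j : (M ⧸ LinearMap.ker f) ≃ₗ[R] N, ∀ x, j (Submodule.Quotient.mk x) = f x := by
  letI : AddCommGroup N := Module.addCommMonoidToAddCommGroup R
  exact ⟨f.quotKerEquivOfSurjective hf, fun x => rfl⟩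

lemma mem_ker_altHom (hΦ : IsRootSystem Φ) (f : GA Φ) :
    f ∈ LinearMap.ker (altHom hΦ) ↔ f ∈ Submodule.span ℂ (kerGens hΦ) := by
  rw [LinearMap.mem_ker, ← alt_eq_zero_iff, ← coe_altHom, Submodule.coe_eq_zero]

set_option synthInstance.maxHeartbeats 1000000 in
set_option maxHeartbeats 1000000 in
/-- The span `M` of the elements `e^μ - ε(w)•e^{wμ}` is a
`ℂ[Λ]^W`-submodule of `ℂ[Λ]`, and `alt` induces an isomorphism of `ℂ[Λ]^W`-modules
`ℂ[Λ]/M ≃ ℂ[Λ]^{W,-}`. -/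
theorem statement0 {V : Type} [NormedAddCommGroup V] [InnerProductSpace ℝ V]
    [FiniteDimensional ℝ V] (Φ : Set V) (hΦ : IsRootSystem Φ) :
    (∀ a ∈ invSubalgebra hΦ, ∀ m ∈ Submodule.span ℂ (kerGens hΦ),
        a * m ∈ Submodule.span ℂ (kerGens hΦ)) ∧
      ∃ M : Submodule ↥(invSubalgebra hΦ) (GA Φ),
        (M : Set (GA Φ)) = ↑(Submodule.span ℂ (kerGens hΦ)) ∧
          ∃ j : (GA Φ ⧸ M) ≃ₗ[↥(invSubalgebra hΦ)] ↥(skewSubmoduleW hΦ),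
            ∀ f : GA Φ, (j (Submodule.Quotient.mk f) : GA Φ) = alt hΦ f := by
  refine ⟨fun a ha m hm => ?_, LinearMap.ker (altHom hΦ), Set.ext (mem_ker_altHom hΦ), ?_⟩
  · rw [← mem_ker_altHom] at hm ⊢
    exact Submodule.smul_mem _ (⟨a, ha⟩ : invSubalgebra hΦ) hm
  · obtain ⟨j, hj⟩ := exists_quotKerEquiv (altHom hΦ) (altHom_surjective hΦ)
    exact ⟨j, fun f => congrArg Subtype.val (hj f)⟩

end CS
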